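/- For every S-complex C~ over a commutative ring R and all integers i and j, there is an S-chain homotopy equivalence Σ^i Σ^j C~ ≃ Σ^{i+j} C~; in particular Σ Σ⁻¹ C~ ≃ C~ ≃ Σ⁻¹ Σ C~. -/

import Mathlib

set_option maxHeartbeats 1000000

open Function

universe u

/-- A `ℤ`-graded `R`-module, presented as an `R`-module together with a family of submodules
(the homogeneous pieces). -/
structure GradedMod (R : Type u) [CommRing R] : Type (u + 1) where
  carrier : Type u
  [isAddCommGroup : AddCommGroup carrier]
  [isModule : Module R carrier]
  grading : ℤ → Submodule R carrier

attribute [instance] GradedMod.isAddCommGroup GradedMod.isModule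

namespace GradedMod

variable {R : Type u} [CommRing R]

/-- `f` is homogeneous of degree `k` with respect to the gradings. -/
def IsDeg (M N : GradedMod R) (k : ℤ) (f : M.carrier →ₗ[R] N.carrier) : Prop :=
  ∀ i : ℤ, (M.grading i).map f ≤ N.grading (i + k)

/-- The grading is an internal direct sum decomposition with finitely generated free pieces,
only finitely many of which are nonzero; i.e., the graded module is finitely generated and
free as a graded `R`-module. -/
def IsFGFree (M : GradedMod R) : Prop :=
  DirectSum.IsInternal M.grading ∧ (∀ i : ℤ, Module.Free R ↥(M.grading i)) ∧
    (∀ i : ℤ, Module.Finite R ↥(M.grading i)) ∧ {i : ℤ | M.grading i ≠ ⊥}.Finite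

/-- `e` is the sign operator `ε`, acting on the degree `i` homogeneous part by `(-1)^i`. -/
def IsSign (M : GradedMod R) (e : M.carrier →ₗ[R] M.carrier) : Prop :=
  ∀ i : ℤ, ∀ x ∈ M.grading i, e x = if Even i then x else -x

/-- The shift `M[n]`, with `M[n]_j = M_{n+j}`. -/
def shift (M : GradedMod R) (n : ℤ) : GradedMod R where
  carrier := M.carrier
  grading j := M.grading (n + j)

/-- Direct sum (product) of graded modules. -/
def prodGM (M N : GradedMod R) : GradedMod R where
  carrier := M.carrier × N.carrier
  grading j := (M.grading j).prod (N.grading j)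

/-- Tensor product of graded modules, `(M ⊗ N)_k = ⊕_{i+j=k} M_i ⊗ N_j`. -/
noncomputable def tensorGM (M N : GradedMod R) : GradedMod R where
  carrier := TensorProduct R M.carrier N.carrier
  grading k := ⨆ i : ℤ, Submodule.map₂ (TensorProduct.mk R M.carrier N.carrier)
      (M.grading i) (N.grading (k - i))

/-- Dual of a graded module: a functional has degree `-i` if it kills all `M_j`, `j ≠ i`. -/
def dualGM (M : GradedMod R) : GradedMod R where
  carrier := Module.Dual R M.carrier
  grading j := ⨅ (i : ℤ) (_ : i ≠ -j), (M.grading i).dualAnnihilator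

end GradedMod

variable {R : Type u} [CommRing R]

/-- Iterated composition of a linear endomorphism. -/
def lpow {M : Type u} [AddCommGroup M] [Module R M] (f : M →ₗ[R] M) : ℕ → (M →ₗ[R] M)
  | 0 => LinearMap.id
  | n + 1 => f ∘ₗ lpow f n

section ProdHelpers

variable {A B C D E : Type u} [AddCommGroup A] [Module R A] [AddCommGroup B] [Module R B]
  [AddCommGroup C] [Module R C] [AddCommGroup D] [Module R D] [AddCommGroup E] [Module R E]

def pj₁ : (A × B × C) →ₗ[R] A := LinearMap.fst R A (B × C)
def pj₂ : (A × B × C) →ₗ[R] B := (LinearMap.fst R B C) ∘ₗ (LinearMap.snd R A (B × C))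
def pj₃ : (A × B × C) →ₗ[R] C := (LinearMap.snd R B C) ∘ₗ (LinearMap.snd R A (B × C))

def tri (f : D →ₗ[R] A) (g : D →ₗ[R] B) (h : D →ₗ[R] C) : D →ₗ[R] A × B × C :=
  f.prod (g.prod h)

def qj₁ : (A × B × C × D) →ₗ[R] A := LinearMap.fst R A (B × C × D)
def qj₂ : (A × B × C × D) →ₗ[R] B := (LinearMap.fst R B (C × D)) ∘ₗ (LinearMap.snd R A (B × C × D))
def qj₃ : (A × B × C × D) →ₗ[R] C :=
  (LinearMap.fst R C D) ∘ₗ (LinearMap.snd R B (C × D)) ∘ₗ (LinearMap.snd R A (B × C × D))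
def qj₄ : (A × B × C × D) →ₗ[R] D :=
  (LinearMap.snd R C D) ∘ₗ (LinearMap.snd R B (C × D)) ∘ₗ (LinearMap.snd R A (B × C × D))

def quad (f : E →ₗ[R] A) (g : E →ₗ[R] B) (h : E →ₗ[R] C) (l : E →ₗ[R] D) :
    E →ₗ[R] A × B × C × D := f.prod (g.prod (h.prod l))

end ProdHelpers

/-- The data of an `S`-complex over `R`: graded modules `C` (irreducible summand) and
`𝖱` (reducible summand), together with the component maps of the differential
`d~ = [[d, 0, 0], [v, −d, δ₂], [δ₁, 0, r]]` with respect to `C~ = C ⊕ C[-1] ⊕ 𝖱`. -/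
structure SCData (R : Type u) [CommRing R] : Type (u + 1) where
  Irr : GradedMod R
  Red : GradedMod R
  d : Irr.carrier →ₗ[R] Irr.carrier
  v : Irr.carrier →ₗ[R] Irr.carrier
  δ₁ : Irr.carrier →ₗ[R] Red.carrier
  δ₂ : Red.carrier →ₗ[R] Irr.carrier
  r : Red.carrier →ₗ[R] Red.carrier

namespace SCData

/-- The five relations equivalent to `d~ ∘ d~ = 0`. -/
def Relations (S : SCData R) : Prop :=
  S.d ∘ₗ S.d = 0 ∧
  S.δ₁ ∘ₗ S.d + S.r ∘ₗ S.δ₁ = 0 ∧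
  S.d ∘ₗ S.δ₂ - S.δ₂ ∘ₗ S.r = 0 ∧
  S.d ∘ₗ S.v - S.v ∘ₗ S.d - S.δ₂ ∘ₗ S.δ₁ = 0 ∧
  S.r ∘ₗ S.r = 0

/-- The degree conditions making `d~` a degree `−1` map on `C~ = C ⊕ C[-1] ⊕ 𝖱`. -/
def Degrees (S : SCData R) : Prop :=
  S.Irr.IsDeg S.Irr (-1) S.d ∧ S.Irr.IsDeg S.Irr (-2) S.v ∧
  S.Irr.IsDeg S.Red (-1) S.δ₁ ∧ S.Red.IsDeg S.Irr (-2) S.δ₂ ∧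
  S.Red.IsDeg S.Red (-1) S.r

/-- `S` is an `S`-complex. -/
def IsSComplex (S : SCData R) : Prop :=
  S.Irr.IsFGFree ∧ S.Red.IsFGFree ∧ S.Degrees ∧ S.Relations

/-- `S` is `r`-perfect: the reducible summand is concentrated in even degrees
(which forces `r = 0` and `δ₁ ∘ v^i ∘ δ₂ = 0` for all `i ≥ 0`). -/
def RPerfect (S : SCData R) : Prop :=
  (∀ j : ℤ, Odd j → S.Red.grading j = ⊥) ∧ S.r = 0 ∧
    ∀ i : ℕ, S.δ₁ ∘ₗ lpow S.v i ∘ₗ S.δ₂ = 0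

/-- The total graded module `C~ = C ⊕ C[-1] ⊕ 𝖱`. -/
def Tot (S : SCData R) : GradedMod R where
  carrier := S.Irr.carrier × S.Irr.carrier × S.Red.carrier
  grading j := (S.Irr.grading j).prod ((S.Irr.grading (j - 1)).prod (S.Red.grading j))

/-- The total differential `d~(c, c', ρ) = (d c, v c − d c' + δ₂ ρ, δ₁ c + r ρ)`. -/
def totalDiff (S : SCData R) : S.Tot.carrier →ₗ[R] S.Tot.carrier :=
  tri (S.d ∘ₗ pj₁) (S.v ∘ₗ pj₁ - S.d ∘ₗ pj₂ + S.δ₂ ∘ₗ pj₃) (S.δ₁ ∘ₗ pj₁ + S.r ∘ₗ pj₃)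

/-- The map `χ(c, c', ρ) = (0, c, 0)`. -/
def totalChi (S : SCData R) : S.Tot.carrier →ₗ[R] S.Tot.carrier :=
  tri 0 pj₁ 0

/-- The suspension `ΣC~`: `C_Σ = C[-2] ⊕ 𝖱[-1]`, `𝖱_Σ = 𝖱`, with the differential of
Definition 2.9 of the paper. -/
def susp (S : SCData R) : SCData R where
  Irr := { carrier := S.Irr.carrier × S.Red.carrier
           grading := fun j => (S.Irr.grading (j - 2)).prod (S.Red.grading (j - 1)) }
  Red := S.Red
  d := LinearMap.prod
      (S.d ∘ₗ LinearMap.fst R S.Irr.carrier S.Red.carrier -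
        S.δ₂ ∘ₗ LinearMap.snd R S.Irr.carrier S.Red.carrier)
      (-(S.r ∘ₗ LinearMap.snd R S.Irr.carrier S.Red.carrier))
  v := LinearMap.prod (S.v ∘ₗ LinearMap.fst R S.Irr.carrier S.Red.carrier)
      (S.δ₁ ∘ₗ LinearMap.fst R S.Irr.carrier S.Red.carrier)
  δ₁ := LinearMap.snd R S.Irr.carrier S.Red.carrier
  δ₂ := LinearMap.prod (S.v ∘ₗ S.δ₂) (S.δ₁ ∘ₗ S.δ₂)
  r := S.r

/-- The negative suspension `Σ⁻¹C~`: `C_{Σ⁻¹} = C[2] ⊕ 𝖱[2]`, `𝖱_{Σ⁻¹} = 𝖱`. -/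
def negSusp (S : SCData R) : SCData R where
  Irr := { carrier := S.Irr.carrier × S.Red.carrier
           grading := fun j => (S.Irr.grading (j + 2)).prod (S.Red.grading (j + 2)) }
  Red := S.Red
  d := LinearMap.prod (S.d ∘ₗ LinearMap.fst R S.Irr.carrier S.Red.carrier)
      (S.δ₁ ∘ₗ LinearMap.fst R S.Irr.carrier S.Red.carrier +
        S.r ∘ₗ LinearMap.snd R S.Irr.carrier S.Red.carrier)
  v := LinearMap.prod (S.v ∘ₗ LinearMap.fst R S.Irr.carrier S.Red.carrier +
        S.δ₂ ∘ₗ LinearMap.snd R S.Irr.carrier S.Red.carrier) 0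
  δ₁ := S.δ₁ ∘ₗ S.v ∘ₗ LinearMap.fst R S.Irr.carrier S.Red.carrier +
        S.δ₁ ∘ₗ S.δ₂ ∘ₗ LinearMap.snd R S.Irr.carrier S.Red.carrier
  δ₂ := LinearMap.prod 0 LinearMap.id
  r := S.r

/-- `Σ^n`, the `n`-fold (negative) suspension. -/
def suspPow (S : SCData R) : ℤ → SCData R
  | Int.ofNat n => (fun X : SCData R => X.susp)^[n] S
  | Int.negSucc n => (fun X : SCData R => X.negSusp)^[n + 1] S

/-- The shifted `S`-complex `C~[n]`: gradings shifted, same differential and `χ`-map. -/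
def shiftSC (S : SCData R) (n : ℤ) : SCData R where
  Irr := S.Irr.shift n
  Red := S.Red.shift n
  d := S.d
  v := S.v
  δ₁ := S.δ₁
  δ₂ := S.δ₂
  r := S.r

end SCData

/-- A map of `S`-complexes in block form `[[λ, 0, 0], [μ, λ, Δ₂], [Δ₁, 0, ρ]]`
(equivalently, a `χ`-equivariant map `C~ → C~'`); used both for morphisms and
(with appropriate signs in the total interpretation) for homotopies. -/
structure SMap {R : Type u} [CommRing R] (S T : SCData R) : Type u where
  lam : S.Irr.carrier →ₗ[R] T.Irr.carrier
  mu : S.Irr.carrier →ₗ[R] T.Irr.carrier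
  del1 : S.Irr.carrier →ₗ[R] T.Red.carrier
  del2 : S.Red.carrier →ₗ[R] T.Irr.carrier
  rho : S.Red.carrier →ₗ[R] T.Red.carrier

namespace SMap

variable {S T U : SCData R}

/-- The component relations equivalent to `d~' λ~ = λ~ d~`. -/
def IsMor (f : SMap S T) : Prop :=
  T.d ∘ₗ f.lam - f.lam ∘ₗ S.d = 0 ∧
  f.del1 ∘ₗ S.d + f.rho ∘ₗ S.δ₁ - T.δ₁ ∘ₗ f.lam - T.r ∘ₗ f.del1 = 0 ∧
  T.d ∘ₗ f.del2 - T.δ₂ ∘ₗ f.rho + f.lam ∘ₗ S.δ₂ + f.del2 ∘ₗ S.r = 0 ∧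
  f.mu ∘ₗ S.d + T.d ∘ₗ f.mu + f.lam ∘ₗ S.v - T.v ∘ₗ f.lam + f.del2 ∘ₗ S.δ₁ - T.δ₂ ∘ₗ f.del1 = 0 ∧
  f.rho ∘ₗ S.r - T.r ∘ₗ f.rho = 0

/-- The components have the degrees of a degree `k` map of `S`-complexes. -/
def DegreesAt (f : SMap S T) (k : ℤ) : Prop :=
  S.Irr.IsDeg T.Irr k f.lam ∧ S.Irr.IsDeg T.Irr (k - 1) f.mu ∧
  S.Irr.IsDeg T.Red k f.del1 ∧ S.Red.IsDeg T.Irr (k - 1) f.del2 ∧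
  S.Red.IsDeg T.Red k f.rho

/-- Composition of morphisms of `S`-complexes, componentwise. -/
def comp (g : SMap T U) (f : SMap S T) : SMap S U where
  lam := g.lam ∘ₗ f.lam
  mu := g.lam ∘ₗ f.mu + g.mu ∘ₗ f.lam + g.del2 ∘ₗ f.del1
  del1 := g.del1 ∘ₗ f.lam + g.rho ∘ₗ f.del1
  del2 := g.lam ∘ₗ f.del2 + g.del2 ∘ₗ f.rho
  rho := g.rho ∘ₗ f.rho

/-- `K` is an `S`-chain homotopy from `f` to `g`, i.e. `d~' K~ + K~ d~ = λ~ - λ~'` where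
`K~ = [[K, 0, 0], [L, -K, M₂], [M₁, 0, J]]`, in component form. -/
def IsHtpyFrom (K f g : SMap S T) : Prop :=
  T.d ∘ₗ K.lam + K.lam ∘ₗ S.d - f.lam + g.lam = 0 ∧
  T.δ₁ ∘ₗ K.lam + T.r ∘ₗ K.del1 + K.del1 ∘ₗ S.d + K.rho ∘ₗ S.δ₁ - f.del1 + g.del1 = 0 ∧
  -(T.d ∘ₗ K.del2) + T.δ₂ ∘ₗ K.rho - K.lam ∘ₗ S.δ₂ + K.del2 ∘ₗ S.r - f.del2 + g.del2 = 0 ∧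
  T.v ∘ₗ K.lam - T.d ∘ₗ K.mu + T.δ₂ ∘ₗ K.del1 + K.mu ∘ₗ S.d - K.lam ∘ₗ S.v + K.del2 ∘ₗ S.δ₁
    - f.mu + g.mu = 0 ∧
  T.r ∘ₗ K.rho + K.rho ∘ₗ S.r - f.rho + g.rho = 0

end SMap

/-- The identity morphism. -/
def idMap (S : SCData R) : SMap S S where
  lam := LinearMap.id
  mu := 0
  del1 := 0
  del2 := 0
  rho := LinearMap.id

/-- The total map `C~ → C~'` of a morphism in block form. -/
def morTotal {S T : SCData R} (f : SMap S T) : S.Tot.carrier →ₗ[R] T.Tot.carrier :=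
  tri (f.lam ∘ₗ pj₁) (f.mu ∘ₗ pj₁ + f.lam ∘ₗ pj₂ + f.del2 ∘ₗ pj₃) (f.del1 ∘ₗ pj₁ + f.rho ∘ₗ pj₃)

/-- The total map `C~ → C~'` of a homotopy in block form. -/
def htpTotal {S T : SCData R} (K : SMap S T) : S.Tot.carrier →ₗ[R] T.Tot.carrier :=
  tri (K.lam ∘ₗ pj₁) (K.mu ∘ₗ pj₁ - K.lam ∘ₗ pj₂ + K.del2 ∘ₗ pj₃) (K.del1 ∘ₗ pj₁ + K.rho ∘ₗ pj₃)

/-- `S`-chain homotopy equivalence of `S`-complexes. -/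
def SHomotopyEquiv (S T : SCData R) : Prop :=
  ∃ (f : SMap S T) (g : SMap T S) (H₁ : SMap S S) (H₂ : SMap T T),
    f.IsMor ∧ f.DegreesAt 0 ∧ g.IsMor ∧ g.DegreesAt 0 ∧
    H₁.DegreesAt 1 ∧ SMap.IsHtpyFrom H₁ (g.comp f) (idMap S) ∧
    H₂.DegreesAt 1 ∧ SMap.IsHtpyFrom H₂ (f.comp g) (idMap T)

/-- Isomorphism of `S`-complexes: a (degree `0`) morphism with a two-sided inverse morphism. -/
def SIso (S T : SCData R) : Prop :=
  ∃ (f : SMap S T) (g : SMap T S), f.IsMor ∧ f.DegreesAt 0 ∧ g.IsMor ∧ g.DegreesAt 0 ∧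
    g.comp f = idMap S ∧ f.comp g = idMap T

/-- The suspension `Σλ~` of a morphism `λ~`, in block form. -/
def suspMap {S T : SCData R} (f : SMap S T) : SMap S.susp T.susp where
  lam := LinearMap.prod
      (f.lam ∘ₗ LinearMap.fst R S.Irr.carrier S.Red.carrier +
        f.del2 ∘ₗ LinearMap.snd R S.Irr.carrier S.Red.carrier)
      (f.rho ∘ₗ LinearMap.snd R S.Irr.carrier S.Red.carrier)
  mu := LinearMap.prod (f.mu ∘ₗ LinearMap.fst R S.Irr.carrier S.Red.carrier)
      (f.del1 ∘ₗ LinearMap.fst R S.Irr.carrier S.Red.carrier)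
  del1 := 0
  del2 := LinearMap.prod (f.mu ∘ₗ S.δ₂ + T.v ∘ₗ f.del2) (f.del1 ∘ₗ S.δ₂ + T.δ₁ ∘ₗ f.del2)
  rho := f.rho

/-- The suspension `ΣK~` of a homotopy `K~`, in block form. -/
def suspHtpy {S T : SCData R} (K : SMap S T) : SMap S.susp T.susp where
  lam := LinearMap.prod
      (K.lam ∘ₗ LinearMap.fst R S.Irr.carrier S.Red.carrier -
        K.del2 ∘ₗ LinearMap.snd R S.Irr.carrier S.Red.carrier)
      (-(K.rho ∘ₗ LinearMap.snd R S.Irr.carrier S.Red.carrier))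
  mu := LinearMap.prod (K.mu ∘ₗ LinearMap.fst R S.Irr.carrier S.Red.carrier)
      (K.del1 ∘ₗ LinearMap.fst R S.Irr.carrier S.Red.carrier)
  del1 := 0
  del2 := LinearMap.prod (T.v ∘ₗ K.del2 + K.mu ∘ₗ S.δ₂) (T.δ₁ ∘ₗ K.del2 + K.del1 ∘ₗ S.δ₂)
  rho := K.rho

/-- The sequence `τ_0 = ρ`, `τ_{i+1} = δ₁'v'^iΔ₂ + Δ₁v^iδ₂ + Σ_{j<i} δ₁'v'^j μ v^{i−1−j} δ₂`
attached to an (even degree) morphism between `r`-perfect `S`-complexes. -/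
def tauSMap {S T : SCData R} (f : SMap S T) : ℕ → (S.Red.carrier →ₗ[R] T.Red.carrier)
  | 0 => f.rho
  | i + 1 =>
      T.δ₁ ∘ₗ lpow T.v i ∘ₗ f.del2 + f.del1 ∘ₗ lpow S.v i ∘ₗ S.δ₂ +
        ∑ j ∈ Finset.range i, T.δ₁ ∘ₗ lpow T.v j ∘ₗ f.mu ∘ₗ lpow S.v (i - 1 - j) ∘ₗ S.δ₂

/-- Height `n` (for `n ≥ 0`): `τ_j = 0` for `0 ≤ j < n`. -/
def SMap.HasHeight {S T : SCData R} (f : SMap S T) (n : ℕ) : Prop :=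
  ∀ j : ℕ, j < n → tauSMap f j = 0

/-- Strong height `n`: height `n` and `τ_n` an isomorphism. -/
def SMap.StrongHeight {S T : SCData R} (f : SMap S T) (n : ℕ) : Prop :=
  f.HasHeight n ∧ Function.Bijective ⇑(tauSMap f n)

/-- The explicit model of the `n`-fold suspension `Σ^n C~` of an `r`-perfect `S`-complex:
`C_{Σ^n} = C[-2n] ⊕ ⊕_{i=0}^{n-1} 𝖱[-2i-1]` (the `m`-th factor of `Fin n → 𝖱` being
`𝖱[-2(n-1-m)-1]`), `𝖱_{Σ^n} = 𝖱`, with the components of the differential as in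
Subsection 2.4 of the paper. -/
def SCData.suspN (S : SCData R) (n : ℕ) : SCData R where
  Irr := { carrier := S.Irr.carrier × (Fin n → S.Red.carrier)
           grading := fun j => (S.Irr.grading (j - 2 * (n : ℤ))).prod
             (Submodule.pi Set.univ fun m : Fin n =>
               S.Red.grading (j - 2 * (((n - 1 - (m : ℕ) : ℕ)) : ℤ) - 1)) }
  Red := S.Red
  d := LinearMap.prod
      (S.d ∘ₗ LinearMap.fst R S.Irr.carrier (Fin n → S.Red.carrier) -
        ∑ m : Fin n, lpow S.v (m : ℕ) ∘ₗ S.δ₂ ∘ₗ LinearMap.proj m ∘ₗ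
          LinearMap.snd R S.Irr.carrier (Fin n → S.Red.carrier)) 0
  v := LinearMap.prod (S.v ∘ₗ LinearMap.fst R S.Irr.carrier (Fin n → S.Red.carrier))
      (LinearMap.pi fun m : Fin n =>
        if (m : ℕ) = 0 then S.δ₁ ∘ₗ LinearMap.fst R S.Irr.carrier (Fin n → S.Red.carrier)
        else LinearMap.proj (⟨(m : ℕ) - 1, lt_of_le_of_lt (Nat.sub_le _ _) m.isLt⟩ : Fin n) ∘ₗ
          LinearMap.snd R S.Irr.carrier (Fin n → S.Red.carrier))
  δ₁ := if h : 0 < n then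
      LinearMap.proj (⟨n - 1, Nat.sub_lt h Nat.one_pos⟩ : Fin n) ∘ₗ
        LinearMap.snd R S.Irr.carrier (Fin n → S.Red.carrier)
    else 0
  δ₂ := LinearMap.prod (lpow S.v n ∘ₗ S.δ₂) 0
  r := 0

/-- The natural morphism `ι~_n : C~ → Σ^n C~`, with `λ`-component `c ↦ (c, 0, …, 0)` and
`Δ₂`-component `θ ↦ (0, θ, 0, …, 0)`. -/
def iotaN (S : SCData R) (n : ℕ) : SMap S (S.suspN n) where
  lam := LinearMap.prod LinearMap.id 0
  mu := 0
  del1 := 0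
  del2 := LinearMap.prod 0 (LinearMap.pi fun m : Fin n => if (m : ℕ) = 0 then LinearMap.id else 0)
  rho := 0

/-- The data of a generalized height morphism between `r`-perfect `S`-complexes:
the four maps `λ, μ, Δ₁, Δ₂` and the sequence `τ_i` for `i ∈ ℤ`. -/
structure HMor {R : Type u} [CommRing R] (S T : SCData R) : Type u where
  lam : S.Irr.carrier →ₗ[R] T.Irr.carrier
  mu : S.Irr.carrier →ₗ[R] T.Irr.carrier
  del1 : S.Irr.carrier →ₗ[R] T.Red.carrier
  del2 : S.Red.carrier →ₗ[R] T.Irr.carrier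
  tau : ℤ → (S.Red.carrier →ₗ[R] T.Red.carrier)

/-- `f` is a height `n` morphism of (even) degree `k` between `r`-perfect `S`-complexes. -/
def HMor.IsHeightMor {S T : SCData R} (f : HMor S T) (n : ℤ) (k : ℤ) : Prop :=
  Even k ∧
  S.Irr.IsDeg T.Irr k f.lam ∧ S.Irr.IsDeg T.Irr (k - 1) f.mu ∧
  S.Irr.IsDeg T.Red k f.del1 ∧ S.Red.IsDeg T.Irr (k - 1) f.del2 ∧
  (∀ i : ℤ, S.Red.IsDeg T.Red (k - 2 * i) (f.tau i)) ∧
  (∀ i : ℤ, i < n → f.tau i = 0) ∧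
  (∀ i : ℕ, f.tau ((i : ℤ) + 1) =
      T.δ₁ ∘ₗ lpow T.v i ∘ₗ f.del2 + f.del1 ∘ₗ lpow S.v i ∘ₗ S.δ₂ +
        ∑ j ∈ Finset.range i, T.δ₁ ∘ₗ lpow T.v j ∘ₗ f.mu ∘ₗ lpow S.v (i - 1 - j) ∘ₗ S.δ₂) ∧
  (T.d ∘ₗ f.lam - f.lam ∘ₗ S.d -
      ∑ᶠ i : ℕ, ∑ j ∈ Finset.range (i + 1),
        lpow T.v j ∘ₗ T.δ₂ ∘ₗ f.tau (-((i : ℤ) + 1)) ∘ₗ S.δ₁ ∘ₗ lpow S.v (i - j) = 0) ∧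
  (-(T.δ₁ ∘ₗ f.lam) + f.del1 ∘ₗ S.d + ∑ᶠ i : ℕ, f.tau (-(i : ℤ)) ∘ₗ S.δ₁ ∘ₗ lpow S.v i = 0) ∧
  (f.lam ∘ₗ S.δ₂ + T.d ∘ₗ f.del2 - ∑ᶠ i : ℕ, lpow T.v i ∘ₗ T.δ₂ ∘ₗ f.tau (-(i : ℤ)) = 0) ∧
  (f.mu ∘ₗ S.d + T.d ∘ₗ f.mu + f.lam ∘ₗ S.v - T.v ∘ₗ f.lam + f.del2 ∘ₗ S.δ₁ - T.δ₂ ∘ₗ f.del1 = 0)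

/-- Composition of generalized height morphisms (Definition 2.23 of the paper). -/
noncomputable def HMor.compH {S T U : SCData R} (g : HMor T U) (f : HMor S T) : HMor S U where
  lam := g.lam ∘ₗ f.lam
    + (∑ᶠ i : ℕ, ∑ j ∈ Finset.range (i + 1),
        lpow U.v j ∘ₗ U.δ₂ ∘ₗ g.tau (-((i : ℤ) + 1)) ∘ₗ f.del1 ∘ₗ lpow S.v (i - j))
    + (∑ᶠ i : ℕ, ∑ j ∈ Finset.range (i + 1),
        lpow U.v j ∘ₗ g.del2 ∘ₗ f.tau (-((i : ℤ) + 1)) ∘ₗ S.δ₁ ∘ₗ lpow S.v (i - j))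
    + (∑ᶠ i : ℕ, ∑ j ∈ Finset.range (i + 1), ∑ l ∈ Finset.range (i - j + 1),
        lpow U.v j ∘ₗ U.δ₂ ∘ₗ g.tau (-((i : ℤ) + 2)) ∘ₗ T.δ₁ ∘ₗ lpow T.v l ∘ₗ f.mu ∘ₗ
          lpow S.v (i - j - l))
    + (∑ᶠ i : ℕ, ∑ j ∈ Finset.range (i + 1), ∑ l ∈ Finset.range (i - j + 1),
        lpow U.v j ∘ₗ g.mu ∘ₗ lpow T.v l ∘ₗ T.δ₂ ∘ₗ f.tau (-((i : ℤ) + 2)) ∘ₗ S.δ₁ ∘ₗ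
          lpow S.v (i - j - l))
  mu := g.lam ∘ₗ f.mu + g.mu ∘ₗ f.lam + g.del2 ∘ₗ f.del1
  del1 := g.del1 ∘ₗ f.lam + (∑ᶠ i : ℕ, g.tau (-(i : ℤ)) ∘ₗ f.del1 ∘ₗ lpow S.v i)
    + (∑ᶠ i : ℕ, ∑ j ∈ Finset.range (i + 1),
        g.tau (-((i : ℤ) + 1)) ∘ₗ T.δ₁ ∘ₗ lpow T.v j ∘ₗ f.mu ∘ₗ lpow S.v (i - j))
  del2 := g.lam ∘ₗ f.del2 + (∑ᶠ i : ℕ, lpow U.v i ∘ₗ g.del2 ∘ₗ f.tau (-(i : ℤ)))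
    + (∑ᶠ i : ℕ, ∑ j ∈ Finset.range (i + 1),
        lpow U.v j ∘ₗ g.mu ∘ₗ lpow T.v (i - j) ∘ₗ T.δ₂ ∘ₗ f.tau (-((i : ℤ) + 1)))
  tau := fun i => ∑ᶠ l : ℤ, g.tau (i - l) ∘ₗ f.tau l

/-- The strong height `−n` morphism `κ~_n : Σ^n C~ → C~`. -/
def kappaN (T : SCData R) (n : ℕ) : HMor (T.suspN n) T where
  lam := LinearMap.fst R T.Irr.carrier (Fin n → T.Red.carrier)
  mu := 0
  del1 := 0
  del2 := 0
  tau := fun i => if i = -(n : ℤ) then LinearMap.id else 0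

/-- An (even degree) morphism of `S`-complexes, regarded as a generalized height morphism. -/
def SMap.toHMor {S T : SCData R} (f : SMap S T) : HMor S T where
  lam := f.lam
  mu := f.mu
  del1 := f.del1
  del2 := f.del2
  tau := fun i => if 0 ≤ i then tauSMap f i.toNat else 0

/-- The height `0` morphism `λ~' : C~ → Σ^n C~'` associated to a height `−n` morphism
(Proposition 2.25 of the paper). -/
def heightNegToSusp {S T : SCData R} (f : HMor S T) (n : ℕ) : SMap S (T.suspN n) where
  lam := LinearMap.prod f.lam
    (LinearMap.pi fun m : Fin n =>
      ∑ i ∈ Finset.Icc ((m : ℕ) + 1) n, f.tau (-(i : ℤ)) ∘ₗ S.δ₁ ∘ₗ lpow S.v (i - 1 - (m : ℕ)))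
  mu := LinearMap.prod f.mu (LinearMap.pi fun m : Fin n => if (m : ℕ) = 0 then f.del1 else 0)
  del1 := 0
  del2 := LinearMap.prod f.del2 (LinearMap.pi fun m : Fin n => f.tau (-((m : ℕ) : ℤ)))
  rho := f.tau (-(n : ℤ))

/-- The morphism `ι~₁ : C~ → ΣC~`. -/
def iotaOne (S : SCData R) : SMap S S.susp where
  lam := LinearMap.prod LinearMap.id 0
  mu := 0
  del1 := 0
  del2 := LinearMap.prod 0 LinearMap.id
  rho := 0

/-- The morphism `λ~'' : ΣC~' → C~''` associated to an odd degree morphism `λ~'` together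
with the map `ν' : 𝖱' → 𝖱''` (Subsection 2.6 of the paper). -/
def lambdaSecond {S T : SCData R} (f : SMap S T) (nu : S.Red.carrier →ₗ[R] T.Red.carrier) :
    SMap S.susp T where
  lam := f.lam ∘ₗ LinearMap.fst R S.Irr.carrier S.Red.carrier +
    f.del2 ∘ₗ LinearMap.snd R S.Irr.carrier S.Red.carrier
  mu := f.mu ∘ₗ LinearMap.fst R S.Irr.carrier S.Red.carrier
  del1 := f.del1 ∘ₗ LinearMap.fst R S.Irr.carrier S.Red.carrier +
    nu ∘ₗ LinearMap.snd R S.Irr.carrier S.Red.carrier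
  del2 := f.mu ∘ₗ S.δ₂ + T.v ∘ₗ f.del2 + T.δ₂ ∘ₗ nu
  rho := 0

/-- The morphism `λ~₁ : C~ → ΣC~'` associated to height `−1` morphism data
`(λ, μ, Δ₁, Δ₂, τ₀, τ₋₁)`, in block form
`[[λ, 0, 0], [τ₋₁δ₁, 0, 0], [μ, λ, Δ₂], [Δ₁, τ₋₁δ₁, τ₀], [0, 0, τ₋₁]]`. -/
def hNegOneSusp {S T : SCData R} (lam0 mu0 : S.Irr.carrier →ₗ[R] T.Irr.carrier)
    (del10 : S.Irr.carrier →ₗ[R] T.Red.carrier) (del20 : S.Red.carrier →ₗ[R] T.Irr.carrier)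
    (tau0 taum1 : S.Red.carrier →ₗ[R] T.Red.carrier) : SMap S T.susp where
  lam := LinearMap.prod lam0 (taum1 ∘ₗ S.δ₁)
  mu := LinearMap.prod mu0 del10
  del1 := 0
  del2 := LinearMap.prod del20 tau0
  rho := taum1

/-- The mapping cone of a degree `k` morphism `λ~ : C~ → C~'`, as an `S`-complex;
its underlying graded module is `C~[-1-k] ⊕ C~'`. -/
def coneSC {S T : SCData R} (f : SMap S T) (k : ℤ) : SCData R where
  Irr := { carrier := S.Irr.carrier × T.Irr.carrier
           grading := fun j => (S.Irr.grading (j - 1 - k)).prod (T.Irr.grading j) }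
  Red := { carrier := S.Red.carrier × T.Red.carrier
           grading := fun j => (S.Red.grading (j - 1 - k)).prod (T.Red.grading j) }
  d := LinearMap.prod (-(S.d ∘ₗ LinearMap.fst R S.Irr.carrier T.Irr.carrier))
      (f.lam ∘ₗ LinearMap.fst R S.Irr.carrier T.Irr.carrier +
        T.d ∘ₗ LinearMap.snd R S.Irr.carrier T.Irr.carrier)
  v := LinearMap.prod (S.v ∘ₗ LinearMap.fst R S.Irr.carrier T.Irr.carrier)
      (f.mu ∘ₗ LinearMap.fst R S.Irr.carrier T.Irr.carrier +
        T.v ∘ₗ LinearMap.snd R S.Irr.carrier T.Irr.carrier)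
  δ₁ := LinearMap.prod (-(S.δ₁ ∘ₗ LinearMap.fst R S.Irr.carrier T.Irr.carrier))
      (f.del1 ∘ₗ LinearMap.fst R S.Irr.carrier T.Irr.carrier +
        T.δ₁ ∘ₗ LinearMap.snd R S.Irr.carrier T.Irr.carrier)
  δ₂ := LinearMap.prod (S.δ₂ ∘ₗ LinearMap.fst R S.Red.carrier T.Red.carrier)
      (f.del2 ∘ₗ LinearMap.fst R S.Red.carrier T.Red.carrier +
        T.δ₂ ∘ₗ LinearMap.snd R S.Red.carrier T.Red.carrier)
  r := LinearMap.prod (-(S.r ∘ₗ LinearMap.fst R S.Red.carrier T.Red.carrier))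
      (f.rho ∘ₗ LinearMap.fst R S.Red.carrier T.Red.carrier +
        T.r ∘ₗ LinearMap.snd R S.Red.carrier T.Red.carrier)

/-- Direct sum of `S`-complexes. -/
def sumSC (S T : SCData R) : SCData R where
  Irr := S.Irr.prodGM T.Irr
  Red := S.Red.prodGM T.Red
  d := S.d.prodMap T.d
  v := S.v.prodMap T.v
  δ₁ := S.δ₁.prodMap T.δ₁
  δ₂ := S.δ₂.prodMap T.δ₂
  r := S.r.prodMap T.r

/-- The dual `S`-complex `C~†`, defined using sign operators on the dual graded modules:
`m†(f) = −ε(f) f ∘ m`, with the roles of `δ₁` and `δ₂` interchanged. -/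
def dualSC (S : SCData R)
    (eCd : Module.Dual R S.Irr.carrier →ₗ[R] Module.Dual R S.Irr.carrier)
    (eRd : Module.Dual R S.Red.carrier →ₗ[R] Module.Dual R S.Red.carrier) : SCData R where
  Irr := S.Irr.dualGM
  Red := S.Red.dualGM
  d := -(S.d.dualMap ∘ₗ eCd)
  v := -(S.v.dualMap ∘ₗ eCd)
  δ₁ := -(S.δ₂.dualMap ∘ₗ eCd)
  δ₂ := -(S.δ₁.dualMap ∘ₗ eRd)
  r := -(S.r.dualMap ∘ₗ eRd)

/-- The rank-one graded module `R`, concentrated in degree `n`. -/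
def unitGM (R : Type u) [CommRing R] (n : ℤ) : GradedMod R where
  carrier := R
  grading j := if j = n then ⊤ else ⊥

/-- The `S`-complex `O~(1)`: `C = R` in degree `1`, `𝖱 = R` in degree `0`, `δ₁ = id`. -/
def O1 (R : Type u) [CommRing R] : SCData R where
  Irr := unitGM R 1
  Red := unitGM R 0
  d := 0
  v := 0
  δ₁ := LinearMap.id
  δ₂ := 0
  r := 0

/-- The `S`-complex `O~(-1)`: `C = R` in degree `-2`, `𝖱 = R` in degree `0`, `δ₂ = id`. -/
def Om1 (R : Type u) [CommRing R] : SCData R where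
  Irr := unitGM R (-2)
  Red := unitGM R 0
  d := 0
  v := 0
  δ₁ := 0
  δ₂ := LinearMap.id
  r := 0

/-- The `S`-complex `O~(0)`: `C = 0`, `𝖱 = R` in degree `0`, zero differential. -/
def O0 (R : Type u) [CommRing R] : SCData R where
  Irr := { carrier := ↥(⊥ : Submodule R R), grading := fun _ => ⊥ }
  Red := unitGM R 0
  d := 0
  v := 0
  δ₁ := 0
  δ₂ := 0
  r := 0

/-- The `S`-complex representation of the tensor product `C~ ⊗ C~'` of `S`-complexes
(Subsection 2.2 of the paper), where `eC`, `eR` are the sign operators of the first factor: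
`C^⊗ = (C⊗C') ⊕ (C⊗C')[-1] ⊕ (C⊗𝖱') ⊕ (𝖱⊗C')` and `𝖱^⊗ = 𝖱⊗𝖱'`. -/
noncomputable def tensorRep (S T : SCData R)
    (eC : S.Irr.carrier →ₗ[R] S.Irr.carrier) (eR : S.Red.carrier →ₗ[R] S.Red.carrier) :
    SCData R where
  Irr := (S.Irr.tensorGM T.Irr).prodGM (((S.Irr.tensorGM T.Irr).shift (-1)).prodGM
      ((S.Irr.tensorGM T.Red).prodGM (S.Red.tensorGM T.Irr)))
  Red := S.Red.tensorGM T.Red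
  d := quad
      (TensorProduct.map S.d LinearMap.id ∘ₗ qj₁ + TensorProduct.map eC T.d ∘ₗ qj₁)
      (TensorProduct.map (-(eC ∘ₗ S.v)) LinearMap.id ∘ₗ qj₁ + TensorProduct.map eC T.v ∘ₗ qj₁
        + TensorProduct.map S.d LinearMap.id ∘ₗ qj₂ - TensorProduct.map eC T.d ∘ₗ qj₂
        + TensorProduct.map eC T.δ₂ ∘ₗ qj₃
        + TensorProduct.map (-(eC ∘ₗ S.δ₂)) LinearMap.id ∘ₗ qj₄)
      (TensorProduct.map eC T.δ₁ ∘ₗ qj₁ + TensorProduct.map S.d LinearMap.id ∘ₗ qj₃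
        + TensorProduct.map eC T.r ∘ₗ qj₃)
      (TensorProduct.map S.δ₁ LinearMap.id ∘ₗ qj₁ + TensorProduct.map eR T.d ∘ₗ qj₄
        + TensorProduct.map S.r LinearMap.id ∘ₗ qj₄)
  v := quad
      (TensorProduct.map S.v LinearMap.id ∘ₗ qj₁ + TensorProduct.map S.δ₂ LinearMap.id ∘ₗ qj₄)
      (TensorProduct.map S.v LinearMap.id ∘ₗ qj₂)
      (TensorProduct.map S.v LinearMap.id ∘ₗ qj₃)
      (TensorProduct.map (eR ∘ₗ S.δ₁) LinearMap.id ∘ₗ qj₂ + TensorProduct.map LinearMap.id T.v ∘ₗ qj₄)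
  δ₁ := TensorProduct.map S.δ₁ LinearMap.id ∘ₗ qj₃ + TensorProduct.map eR T.δ₁ ∘ₗ qj₄
  δ₂ := quad 0 0 (TensorProduct.map S.δ₂ LinearMap.id) (TensorProduct.map LinearMap.id T.δ₂)
  r := TensorProduct.map S.r LinearMap.id + TensorProduct.map eR T.r

/-- Homology of an endomorphism (thought of as a differential): `ker D / im D`. -/
abbrev homologyOf {M : Type u} [AddCommGroup M] [Module R M] (D : M →ₗ[R] M) : Type u :=
  ↥(LinearMap.ker D) ⧸
    Submodule.comap (LinearMap.ker D).subtype (LinearMap.range D)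

/-- The map induced on homology by a chain map. -/
def inducedMap {M N : Type u} [AddCommGroup M] [Module R M] [AddCommGroup N] [Module R N]
    (DM : M →ₗ[R] M) (DN : N →ₗ[R] N) (f : M →ₗ[R] N) (h : DN ∘ₗ f = f ∘ₗ DM) :
    homologyOf DM →ₗ[R] homologyOf DN :=
  Submodule.mapQ _ _
    (f.restrict (p := LinearMap.ker DM) (q := LinearMap.ker DN) (fun x hx => by
      have h1 : DN (f x) = f (DM x) := by
        have h2 := LinearMap.congr_fun h x
        simpa using h2
      have hx0 : DM x = 0 := LinearMap.mem_ker.mp hx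
      simp [LinearMap.mem_ker, h1, hx0]))
    (by
      intro x hx
      simp only [Submodule.mem_comap] at hx ⊢
      obtain ⟨y, hy⟩ := hx
      refine ⟨f y, ?_⟩
      have h1 : DN (f y) = f (DM y) := by
        have h2 := LinearMap.congr_fun h y
        simpa using h2
      simp only [Submodule.coe_subtype] at hy ⊢
      rw [LinearMap.restrict_apply]
      rw [h1, hy])

/-- The degree `j` homology of a graded module with a (degree `-1`) differential. -/
abbrev gradedHomology (M : GradedMod R) (D : M.carrier →ₗ[R] M.carrier) (j : ℤ) : Type u :=
  ↥(M.grading j ⊓ LinearMap.ker D) ⧸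
    Submodule.comap (M.grading j ⊓ LinearMap.ker D).subtype ((M.grading (j + 1)).map D)

/-- The Euler characteristic `Σ_j (-1)^j rk_R M_j` of a graded module. -/
noncomputable def eulerChar (M : GradedMod R) : ℤ :=
  ∑ᶠ j : ℤ, (if Even j then (1 : ℤ) else -1) * (Module.finrank R ↥(M.grading j) : ℤ)

/-- The small equivariant complex `Ĉ = C[-1] ⊕ 𝖱[x]`, with `𝖱[x]` modelled as `ℕ →₀ 𝖱`. -/
abbrev hatC (S : SCData R) : Type u := S.Irr.carrier × (ℕ →₀ S.Red.carrier)

/-- The differential `𝔡̂(α, θxⁱ) = (dα − vⁱδ₂θ, 0)`. -/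
noncomputable def hatD (S : SCData R) : hatC S →ₗ[R] hatC S :=
  LinearMap.prod
    (S.d ∘ₗ LinearMap.fst R S.Irr.carrier (ℕ →₀ S.Red.carrier) -
      (Finsupp.lsum ℕ fun i : ℕ => lpow S.v i ∘ₗ S.δ₂) ∘ₗ
        LinearMap.snd R S.Irr.carrier (ℕ →₀ S.Red.carrier))
    0

/-- The `x`-action `x·(α, θxⁱ) = (vα, δ₁α + θx^{i+1})` on `Ĉ`. -/
noncomputable def hatX (S : SCData R) : hatC S →ₗ[R] hatC S :=
  LinearMap.prod (S.v ∘ₗ LinearMap.fst R S.Irr.carrier (ℕ →₀ S.Red.carrier))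
    (Finsupp.lsingle 0 ∘ₗ S.δ₁ ∘ₗ LinearMap.fst R S.Irr.carrier (ℕ →₀ S.Red.carrier) +
      Finsupp.lmapDomain S.Red.carrier R (fun i => i + 1) ∘ₗ
        LinearMap.snd R S.Irr.carrier (ℕ →₀ S.Red.carrier))

/-- The small equivariant complex `Č = C ⊕ 𝖱[[x⁻¹,x]/𝖱[x]`, the tail modelled as `ℕ → 𝖱`
(the `m`-th coordinate is the coefficient of `x^{-m-1}`). -/
abbrev checkC (S : SCData R) : Type u := S.Irr.carrier × (ℕ → S.Red.carrier)

/-- The differential `𝔡̌(α, θxⁱ) = (dα, Σ_{j≤-1} δ₁v^{−j−1}(α)xʲ)`. -/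
noncomputable def checkD (S : SCData R) : checkC S →ₗ[R] checkC S :=
  LinearMap.prod (S.d ∘ₗ LinearMap.fst R S.Irr.carrier (ℕ → S.Red.carrier))
    (LinearMap.pi fun m : ℕ =>
      S.δ₁ ∘ₗ lpow S.v m ∘ₗ LinearMap.fst R S.Irr.carrier (ℕ → S.Red.carrier))

/-- The `x`-action on `Č`. -/
noncomputable def checkX (S : SCData R) : checkC S →ₗ[R] checkC S :=
  LinearMap.prod
    (S.v ∘ₗ LinearMap.fst R S.Irr.carrier (ℕ → S.Red.carrier) +
      S.δ₂ ∘ₗ LinearMap.proj 0 ∘ₗ LinearMap.snd R S.Irr.carrier (ℕ → S.Red.carrier))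
    (LinearMap.pi fun m : ℕ =>
      LinearMap.proj (m + 1) ∘ₗ LinearMap.snd R S.Irr.carrier (ℕ → S.Red.carrier))

/-- The module `𝖱[[x⁻¹,x]` of Laurent series with finitely many positive powers, modelled
as (polynomial part, tail): `(ℕ →₀ 𝖱) × (ℕ → 𝖱)`. -/
abbrev barC (S : SCData R) : Type u := (ℕ →₀ S.Red.carrier) × (ℕ → S.Red.carrier)

/-- Multiplication by `x` on `𝖱[[x⁻¹,x]`. -/
noncomputable def barX (S : SCData R) : barC S →ₗ[R] barC S :=
  LinearMap.prod
    (Finsupp.lsingle 0 ∘ₗ LinearMap.proj 0 ∘ₗ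
        LinearMap.snd R (ℕ →₀ S.Red.carrier) (ℕ → S.Red.carrier) +
      Finsupp.lmapDomain S.Red.carrier R (fun i => i + 1) ∘ₗ
        LinearMap.fst R (ℕ →₀ S.Red.carrier) (ℕ → S.Red.carrier))
    (LinearMap.pi fun m : ℕ =>
      LinearMap.proj (m + 1) ∘ₗ LinearMap.snd R (ℕ →₀ S.Red.carrier) (ℕ → S.Red.carrier))

/-- The chain map `𝔦 : Ĉ → 𝖱[[x⁻¹,x]`, `(α, θ) ↦ Σ_{i≤-1} δ₁v^{−i−1}(α)xⁱ + θ`. -/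
noncomputable def mapI (S : SCData R) : hatC S →ₗ[R] barC S :=
  LinearMap.prod (LinearMap.snd R S.Irr.carrier (ℕ →₀ S.Red.carrier))
    (LinearMap.pi fun m : ℕ =>
      S.δ₁ ∘ₗ lpow S.v m ∘ₗ LinearMap.fst R S.Irr.carrier (ℕ →₀ S.Red.carrier))

/-- The chain map `𝔧 : Č → Ĉ`, `(α, ·) ↦ (−α, 0)`. -/
noncomputable def mapJ (S : SCData R) : checkC S →ₗ[R] hatC S :=
  LinearMap.prod (-(LinearMap.fst R S.Irr.carrier (ℕ → S.Red.carrier))) 0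

/-- The chain map `𝔭 : 𝖱[[x⁻¹,x] → Č`, `Σθᵢxⁱ ↦ (Σ_{i≥0} vⁱδ₂θᵢ, Σ_{i≤-1} θᵢxⁱ)`. -/
noncomputable def mapP (S : SCData R) : barC S →ₗ[R] checkC S :=
  LinearMap.prod
    ((Finsupp.lsum ℕ fun i : ℕ => lpow S.v i ∘ₗ S.δ₂) ∘ₗ
      LinearMap.fst R (ℕ →₀ S.Red.carrier) (ℕ → S.Red.carrier))
    (LinearMap.snd R (ℕ →₀ S.Red.carrier) (ℕ → S.Red.carrier))

/-- The coefficient of `xᵉ`, as a linear map `𝖱[[x⁻¹,x] → 𝖱`. -/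
noncomputable def coeffLM (S : SCData R) (e : ℤ) : barC S →ₗ[R] S.Red.carrier :=
  if 0 ≤ e then
    Finsupp.lapply e.toNat ∘ₗ LinearMap.fst R (ℕ →₀ S.Red.carrier) (ℕ → S.Red.carrier)
  else
    LinearMap.proj (-e - 1).toNat ∘ₗ LinearMap.snd R (ℕ →₀ S.Red.carrier) (ℕ → S.Red.carrier)

/-- `𝔍(C~) ⊆ 𝖱[[x⁻¹,x]`, the image of `i⋆ : Ĥ → 𝖱[[x⁻¹,x]` (equal to `𝔦(ker 𝔡̂)`). -/
noncomputable def Jmod (S : SCData R) : Submodule R (barC S) :=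
  (LinearMap.ker (hatD S)).map (mapI S)

/-- `J_i(C~) = { a₀ ∈ 𝖱 | ∃ a₀x^{-i} + a₋₁x^{-i-1} + ⋯ ∈ 𝔍(C~) }`. -/
noncomputable def Jset (S : SCData R) (i : ℤ) : Submodule R S.Red.carrier :=
  ((Jmod S) ⊓ ⨅ (e : ℤ) (_ : -i < e), LinearMap.ker (coeffLM S e)).map (coeffLM S (-i))

/-- The function `d_{C~}(i) = rk_R J_i(C~)`. -/
noncomputable def dFun (S : SCData R) (i : ℤ) : ℕ := Module.finrank R ↥(Jset S i)

theorem GradedMod.isDeg_iff {M N : GradedMod R} {k : ℤ} {f : M.carrier →ₗ[R] N.carrier} :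
    M.IsDeg N k f ↔ ∀ i j : ℤ, i + k = j → ∀ x ∈ M.grading i, f x ∈ N.grading j := by
  constructor
  · rintro h i _ rfl x hx
    exact h i (Submodule.mem_map_of_mem hx)
  · rintro h i _ ⟨x, hx, rfl⟩
    exact h i _ rfl x hx

theorem SCData.relations_iff {S : SCData R} : S.Relations ↔
    (∀ x, S.d (S.d x) = 0) ∧
    (∀ x, S.r (S.δ₁ x) = -S.δ₁ (S.d x)) ∧
    (∀ x, S.d (S.δ₂ x) = S.δ₂ (S.r x)) ∧
    (∀ x, S.d (S.v x) = S.v (S.d x) + S.δ₂ (S.δ₁ x)) ∧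
    (∀ x, S.r (S.r x) = 0) := by
  simp only [SCData.Relations, LinearMap.ext_iff, LinearMap.comp_apply, LinearMap.add_apply,
    LinearMap.sub_apply, LinearMap.zero_apply]
  refine and_congr Iff.rfl (and_congr ?_ (and_congr ?_ (and_congr ?_ Iff.rfl))) <;>
    exact forall_congr' fun x => by grind

namespace SMap

variable {S T U : SCData R}

theorem isMor_iff {f : SMap S T} : f.IsMor ↔
    (∀ x, T.d (f.lam x) = f.lam (S.d x)) ∧
    (∀ x, T.r (f.del1 x) = f.del1 (S.d x) + f.rho (S.δ₁ x) - T.δ₁ (f.lam x)) ∧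
    (∀ x, T.d (f.del2 x) = T.δ₂ (f.rho x) - f.lam (S.δ₂ x) - f.del2 (S.r x)) ∧
    (∀ x, T.d (f.mu x) = T.v (f.lam x) + T.δ₂ (f.del1 x) - f.mu (S.d x) - f.lam (S.v x)
      - f.del2 (S.δ₁ x)) ∧
    (∀ x, T.r (f.rho x) = f.rho (S.r x)) := by
  simp only [SMap.IsMor, LinearMap.ext_iff, LinearMap.comp_apply, LinearMap.add_apply,
    LinearMap.sub_apply, LinearMap.zero_apply]
  refine and_congr ?_ (and_congr ?_ (and_congr ?_ (and_congr ?_ ?_))) <;>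
    exact forall_congr' fun x => by grind

theorem isHtpyFrom_iff {K f g : SMap S T} : IsHtpyFrom K f g ↔
    (∀ x, T.d (K.lam x) = f.lam x - g.lam x - K.lam (S.d x)) ∧
    (∀ x, T.r (K.del1 x) = f.del1 x - g.del1 x - T.δ₁ (K.lam x) - K.del1 (S.d x)
      - K.rho (S.δ₁ x)) ∧
    (∀ x, T.d (K.del2 x) = g.del2 x - f.del2 x + T.δ₂ (K.rho x) - K.lam (S.δ₂ x)
      + K.del2 (S.r x)) ∧
    (∀ x, T.d (K.mu x) = g.mu x - f.mu x + T.v (K.lam x) + T.δ₂ (K.del1 x) + K.mu (S.d x)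
      - K.lam (S.v x) + K.del2 (S.δ₁ x)) ∧
    (∀ x, T.r (K.rho x) = f.rho x - g.rho x - K.rho (S.r x)) := by
  simp only [SMap.IsHtpyFrom, LinearMap.ext_iff, LinearMap.comp_apply, LinearMap.add_apply,
    LinearMap.sub_apply, LinearMap.neg_apply, LinearMap.zero_apply]
  refine and_congr ?_ (and_congr ?_ (and_congr ?_ (and_congr ?_ ?_))) <;>
    exact forall_congr' fun x => by grind

theorem IsMor.comp {g : SMap T U} {f : SMap S T} (hg : g.IsMor) (hf : f.IsMor) :
    (g.comp f).IsMor := by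
  rw [isMor_iff] at *
  obtain ⟨g1, g2, g3, g4, g5⟩ := hg
  obtain ⟨f1, f2, f3, f4, f5⟩ := hf
  refine ⟨fun x => ?_, fun x => ?_, fun x => ?_, fun x => ?_, fun x => ?_⟩ <;>
    simp only [SMap.comp, LinearMap.comp_apply, LinearMap.add_apply, map_add, map_sub, *] <;> abel

/-- The composite `K~ ∘ f~` of a homotopy with a morphism, in block form. -/
def htpyComp (K : SMap T U) (f : SMap S T) : SMap S U where
  lam := K.lam ∘ₗ f.lam
  mu := K.mu ∘ₗ f.lam - K.lam ∘ₗ f.mu + K.del2 ∘ₗ f.del1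
  del1 := K.del1 ∘ₗ f.lam + K.rho ∘ₗ f.del1
  del2 := K.del2 ∘ₗ f.rho - K.lam ∘ₗ f.del2
  rho := K.rho ∘ₗ f.rho

theorem IsHtpyFrom.comp_left {K f f' : SMap S T} {g : SMap T U} (hg : g.IsMor)
    (hK : IsHtpyFrom K f f') : IsHtpyFrom (g.comp K) (g.comp f) (g.comp f') := by
  rw [isMor_iff] at hg
  rw [isHtpyFrom_iff] at *
  obtain ⟨g1, g2, g3, g4, g5⟩ := hg
  obtain ⟨f1, f2, f3, f4, f5⟩ := hK
  refine ⟨fun x => ?_, fun x => ?_, fun x => ?_, fun x => ?_, fun x => ?_⟩ <;>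
    simp only [SMap.comp, LinearMap.comp_apply, LinearMap.add_apply, map_add, map_sub, *] <;> abel

theorem IsHtpyFrom.comp_right {K g g' : SMap T U} {f : SMap S T} (hf : f.IsMor)
    (hK : IsHtpyFrom K g g') : IsHtpyFrom (htpyComp K f) (g.comp f) (g'.comp f) := by
  rw [isMor_iff] at hf
  rw [isHtpyFrom_iff] at *
  obtain ⟨g1, g2, g3, g4, g5⟩ := hf
  obtain ⟨f1, f2, f3, f4, f5⟩ := hK
  refine ⟨fun x => ?_, fun x => ?_, fun x => ?_, fun x => ?_, fun x => ?_⟩ <;>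
    simp only [SMap.comp, htpyComp, LinearMap.comp_apply, LinearMap.add_apply,
      LinearMap.sub_apply, map_add, map_sub, *] <;> abel

theorem IsMor.suspMap {f : SMap S T} (hS : S.Relations) (hT : T.Relations) (hf : f.IsMor) :
    (suspMap f).IsMor := by
  rw [SCData.relations_iff] at hS hT
  rw [isMor_iff] at *
  obtain ⟨s1, s2, s3, s4, s5⟩ := hS
  obtain ⟨t1, t2, t3, t4, t5⟩ := hT
  obtain ⟨f1, f2, f3, f4, f5⟩ := hf
  refine ⟨fun (x, y) => Prod.ext ?_ ?_, fun (x, y) => ?_,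
    fun (x : S.Red.carrier) => Prod.ext ?_ ?_, fun (x, y) => Prod.ext ?_ ?_,
    fun (x : S.Red.carrier) => ?_⟩ <;> delta _root_.suspMap SCData.susp <;> simp [*] <;> abel

theorem IsHtpyFrom.suspHtpy {K f g : SMap S T} (hS : S.Relations) (hT : T.Relations)
    (hK : IsHtpyFrom K f g) : IsHtpyFrom (suspHtpy K) (suspMap f) (suspMap g) := by
  rw [SCData.relations_iff] at hS hT
  rw [isHtpyFrom_iff] at *
  obtain ⟨s1, s2, s3, s4, s5⟩ := hS
  obtain ⟨t1, t2, t3, t4, t5⟩ := hT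
  obtain ⟨k1, k2, k3, k4, k5⟩ := hK
  refine ⟨fun (x, y) => Prod.ext ?_ ?_, fun (x, y) => ?_,
    fun (x : S.Red.carrier) => Prod.ext ?_ ?_, fun (x, y) => Prod.ext ?_ ?_,
    fun (x : S.Red.carrier) => ?_⟩ <;>
    delta _root_.suspHtpy _root_.suspMap SCData.susp <;> simp [*] <;> abel

/-- The homotopy from `Σg~ ∘ Σf~` to `Σ(g~ ∘ f~)`. -/
def suspCompHtpy (g : SMap T U) (f : SMap S T) : SMap S.susp U.susp where
  lam := 0
  mu := 0
  del1 := 0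
  del2 := LinearMap.prod (g.mu ∘ₗ f.del2) (g.del1 ∘ₗ f.del2)
  rho := 0

theorem isHtpyFrom_suspCompHtpy {g : SMap T U} {f : SMap S T} (hg : g.IsMor) (hf : f.IsMor) :
    IsHtpyFrom (suspCompHtpy g f) ((suspMap g).comp (suspMap f)) (suspMap (g.comp f)) := by
  rw [isMor_iff] at hg hf
  rw [isHtpyFrom_iff]
  obtain ⟨g1, g2, g3, g4, g5⟩ := hg
  obtain ⟨f1, f2, f3, f4, f5⟩ := hf
  refine ⟨fun (x, y) => Prod.ext ?_ ?_, fun (x, y) => ?_,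
    fun (x : S.Red.carrier) => Prod.ext ?_ ?_, fun (x, y) => Prod.ext ?_ ?_,
    fun (x : S.Red.carrier) => ?_⟩ <;>
    delta suspCompHtpy _root_.suspMap SMap.comp SCData.susp <;> simp [*] <;> abel

theorem suspMap_idMap : suspMap (idMap S) = idMap S.susp := by
  delta suspMap idMap SCData.susp
  simp only [SMap.mk.injEq]
  refine ⟨?_, ?_, trivial, ?_, trivial⟩ <;> ext <;> simp

/-- The negative suspension of a morphism. -/
def negSuspMap (f : SMap S T) : SMap S.negSusp T.negSusp where
  lam := LinearMap.prod (f.lam ∘ₗ LinearMap.fst R S.Irr.carrier S.Red.carrier)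
      (f.del1 ∘ₗ LinearMap.fst R S.Irr.carrier S.Red.carrier +
        f.rho ∘ₗ LinearMap.snd R S.Irr.carrier S.Red.carrier)
  mu := LinearMap.prod (f.mu ∘ₗ LinearMap.fst R S.Irr.carrier S.Red.carrier +
        f.del2 ∘ₗ LinearMap.snd R S.Irr.carrier S.Red.carrier) 0
  del1 := (T.δ₁ ∘ₗ f.mu + f.del1 ∘ₗ S.v) ∘ₗ LinearMap.fst R S.Irr.carrier S.Red.carrier +
    (T.δ₁ ∘ₗ f.del2 + f.del1 ∘ₗ S.δ₂) ∘ₗ LinearMap.snd R S.Irr.carrier S.Red.carrier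
  del2 := 0
  rho := f.rho

theorem IsMor.negSuspMap {f : SMap S T} (hS : S.Relations) (hT : T.Relations) (hf : f.IsMor) :
    (negSuspMap f).IsMor := by
  rw [SCData.relations_iff] at hS hT
  rw [isMor_iff] at *
  obtain ⟨s1, s2, s3, s4, s5⟩ := hS
  obtain ⟨t1, t2, t3, t4, t5⟩ := hT
  obtain ⟨f1, f2, f3, f4, f5⟩ := hf
  refine ⟨fun (x, y) => Prod.ext ?_ ?_, fun (x, y) => ?_,
    fun (x : S.Red.carrier) => Prod.ext ?_ ?_, fun (x, y) => Prod.ext ?_ ?_,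
    fun (x : S.Red.carrier) => ?_⟩ <;>
    delta SMap.negSuspMap SCData.negSusp <;> simp [*] <;> abel

/-- The negative suspension of a homotopy is given by the same block form as that of a
morphism. -/
theorem IsHtpyFrom.negSuspMap {K f g : SMap S T} (hS : S.Relations) (hT : T.Relations)
    (hK : IsHtpyFrom K f g) :
    IsHtpyFrom (negSuspMap K) (negSuspMap f) (negSuspMap g) := by
  rw [SCData.relations_iff] at hS hT
  rw [isHtpyFrom_iff] at *
  obtain ⟨s1, s2, s3, s4, s5⟩ := hS
  obtain ⟨t1, t2, t3, t4, t5⟩ := hT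
  obtain ⟨k1, k2, k3, k4, k5⟩ := hK
  refine ⟨fun (x, y) => Prod.ext ?_ ?_, fun (x, y) => ?_,
    fun (x : S.Red.carrier) => Prod.ext ?_ ?_, fun (x, y) => Prod.ext ?_ ?_,
    fun (x : S.Red.carrier) => ?_⟩ <;>
    delta SMap.negSuspMap SCData.negSusp <;> simp [*] <;> abel

/-- The homotopy from `Σ⁻¹g~ ∘ Σ⁻¹f~` to `Σ⁻¹(g~ ∘ f~)`. -/
def negSuspCompHtpy (g : SMap T U) (f : SMap S T) : SMap S.negSusp U.negSusp where
  lam := 0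
  mu := 0
  del1 := g.del1 ∘ₗ f.mu ∘ₗ LinearMap.fst R S.Irr.carrier S.Red.carrier +
    g.del1 ∘ₗ f.del2 ∘ₗ LinearMap.snd R S.Irr.carrier S.Red.carrier
  del2 := 0
  rho := 0

theorem isHtpyFrom_negSuspCompHtpy {g : SMap T U} {f : SMap S T} (hg : g.IsMor) (hf : f.IsMor) :
    IsHtpyFrom (negSuspCompHtpy g f) ((negSuspMap g).comp (negSuspMap f))
      (negSuspMap (g.comp f)) := by
  rw [isMor_iff] at hg hf
  rw [isHtpyFrom_iff]
  obtain ⟨g1, g2, g3, g4, g5⟩ := hg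
  obtain ⟨f1, f2, f3, f4, f5⟩ := hf
  refine ⟨fun (x, y) => Prod.ext ?_ ?_, fun (x, y) => ?_,
    fun (x : S.Red.carrier) => Prod.ext ?_ ?_, fun (x, y) => Prod.ext ?_ ?_,
    fun (x : S.Red.carrier) => ?_⟩ <;>
    delta negSuspCompHtpy SMap.negSuspMap SMap.comp SCData.negSusp <;> simp [*] <;> abel

theorem negSuspMap_idMap : negSuspMap (idMap S) = idMap S.negSusp := by
  delta negSuspMap idMap SCData.negSusp
  simp only [SMap.mk.injEq]
  refine ⟨?_, ?_, ?_, trivial, trivial⟩ <;> ext <;> simp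

theorem idMap_comp (f : SMap S T) : (idMap T).comp f = f := by
  cases f
  simp [SMap.comp, idMap]

theorem comp_assoc {V : SCData R} (h : SMap U V) (g : SMap T U) (f : SMap S T) :
    (h.comp g).comp f = h.comp (g.comp f) := by
  simp only [SMap.comp, LinearMap.comp_add, LinearMap.add_comp, LinearMap.comp_assoc,
    SMap.mk.injEq, true_and, and_true]
  refine ⟨?_, ?_, ?_⟩ <;> abel

theorem isMor_idMap : (idMap S).IsMor := by
  simp [SMap.isMor_iff, idMap]

end SMap

namespace GradedMod.IsDeg

variable {M N P : GradedMod R} {k l m : ℤ}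

theorem zero : M.IsDeg N k 0 := by
  simp [isDeg_iff]

theorem id (hk : k = 0) : M.IsDeg M k LinearMap.id := by
  subst hk
  simp [isDeg_iff]

theorem comp {g : N.carrier →ₗ[R] P.carrier} {f : M.carrier →ₗ[R] N.carrier}
    (hg : N.IsDeg P l g) (hf : M.IsDeg N k f) (hm : m = k + l) : M.IsDeg P m (g ∘ₗ f) := by
  rw [isDeg_iff] at *
  exact fun i j e x hx => hg (i + k) j (by omega) _ (hf i _ rfl x hx)

theorem add {f g : M.carrier →ₗ[R] N.carrier} (hf : M.IsDeg N k f) (hg : M.IsDeg N k g) :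
    M.IsDeg N k (f + g) := by
  rw [isDeg_iff] at *
  exact fun i j e x hx => add_mem (hf i j e x hx) (hg i j e x hx)

theorem neg {f : M.carrier →ₗ[R] N.carrier} (hf : M.IsDeg N k f) : M.IsDeg N k (-f) := by
  rw [isDeg_iff] at *
  exact fun i j e x hx => neg_mem (hf i j e x hx)

theorem sub {f g : M.carrier →ₗ[R] N.carrier} (hf : M.IsDeg N k f) (hg : M.IsDeg N k g) :
    M.IsDeg N k (f - g) := by
  rw [sub_eq_add_neg]
  exact hf.add hg.neg

section Suspension

variable {S : SCData R}

theorem susp_fst : S.susp.Irr.IsDeg S.Irr (-2) (LinearMap.fst R S.Irr.carrier S.Red.carrier) :=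
  isDeg_iff.mpr fun _ _ e _ hx => e ▸ hx.1

theorem susp_snd : S.susp.Irr.IsDeg S.Red (-1) (LinearMap.snd R S.Irr.carrier S.Red.carrier) :=
  isDeg_iff.mpr fun _ _ e _ hx => e ▸ hx.2

theorem susp_prod {f : M.carrier →ₗ[R] S.Irr.carrier} {g : M.carrier →ₗ[R] S.Red.carrier}
    (hf : M.IsDeg S.Irr (k - 2) f) (hg : M.IsDeg S.Red (k - 1) g) :
    M.IsDeg S.susp.Irr k (LinearMap.prod f g) := by
  rw [isDeg_iff] at hf hg
  exact isDeg_iff.mpr fun i j e x hx => ⟨hf i _ (by omega) x hx, hg i _ (by omega) x hx⟩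

theorem negSusp_fst :
    S.negSusp.Irr.IsDeg S.Irr 2 (LinearMap.fst R S.Irr.carrier S.Red.carrier) :=
  isDeg_iff.mpr fun _ _ e _ hx => e ▸ hx.1

theorem negSusp_snd :
    S.negSusp.Irr.IsDeg S.Red 2 (LinearMap.snd R S.Irr.carrier S.Red.carrier) :=
  isDeg_iff.mpr fun _ _ e _ hx => e ▸ hx.2

theorem negSusp_prod {f : M.carrier →ₗ[R] S.Irr.carrier} {g : M.carrier →ₗ[R] S.Red.carrier}
    (hf : M.IsDeg S.Irr (k + 2) f) (hg : M.IsDeg S.Red (k + 2) g) :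
    M.IsDeg S.negSusp.Irr k (LinearMap.prod f g) := by
  rw [isDeg_iff] at hf hg
  exact isDeg_iff.mpr fun i j e x hx => ⟨hf i _ (by omega) x hx, hg i _ (by omega) x hx⟩

end Suspension

end GradedMod.IsDeg

namespace SCData

open GradedMod.IsDeg

variable {S : SCData R}

theorem Relations.susp (hS : S.Relations) : S.susp.Relations := by
  rw [relations_iff] at *
  obtain ⟨s1, s2, s3, s4, s5⟩ := hS
  refine ⟨fun (x, y) => Prod.ext ?_ ?_, fun (x, y) => ?_,
    fun (x : S.Red.carrier) => Prod.ext ?_ ?_, fun (x, y) => Prod.ext ?_ ?_,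
    fun (x : S.Red.carrier) => ?_⟩ <;>
    delta SCData.susp <;> simp [*]

theorem Relations.negSusp (hS : S.Relations) : S.negSusp.Relations := by
  rw [relations_iff] at *
  obtain ⟨s1, s2, s3, s4, s5⟩ := hS
  refine ⟨fun (x, y) => Prod.ext ?_ ?_, fun (x, y) => ?_,
    fun (x : S.Red.carrier) => Prod.ext ?_ ?_, fun (x, y) => Prod.ext ?_ ?_,
    fun (x : S.Red.carrier) => ?_⟩ <;>
    delta SCData.negSusp <;> simp [*] <;> abel

theorem Degrees.susp (hS : S.Degrees) : S.susp.Degrees := by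
  obtain ⟨hd, hv, h1, h2, hr⟩ := hS
  exact ⟨susp_prod (.sub (.comp hd susp_fst rfl) (.comp h2 susp_snd rfl))
      (.neg (.comp hr susp_snd rfl)),
    susp_prod (.comp hv susp_fst rfl) (.comp h1 susp_fst rfl), susp_snd,
    susp_prod (.comp hv h2 rfl) (.comp h1 h2 rfl), hr⟩

theorem Degrees.negSusp (hS : S.Degrees) : S.negSusp.Degrees := by
  obtain ⟨hd, hv, h1, h2, hr⟩ := hS
  exact ⟨negSusp_prod (.comp hd negSusp_fst rfl)
      (.add (.comp h1 negSusp_fst rfl) (.comp hr negSusp_snd rfl)),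
    negSusp_prod (.add (.comp hv negSusp_fst rfl) (.comp h2 negSusp_snd rfl)) .zero,
    .add (.comp h1 (.comp hv negSusp_fst rfl) rfl) (.comp h1 (.comp h2 negSusp_snd rfl) rfl),
    negSusp_prod .zero (.id rfl), hr⟩

end SCData

namespace SMap.DegreesAt

open GradedMod.IsDeg

variable {S T U : SCData R} {k l m : ℤ}

theorem idMap : (idMap S).DegreesAt 0 :=
  ⟨.id rfl, .zero, .zero, .zero, .id rfl⟩

theorem comp {g : SMap T U} {f : SMap S T} (hg : g.DegreesAt l) (hf : f.DegreesAt k)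
    (hm : m = k + l) : (g.comp f).DegreesAt m := by
  subst hm
  obtain ⟨g1, g2, g3, g4, g5⟩ := hg
  obtain ⟨f1, f2, f3, f4, f5⟩ := hf
  exact ⟨.comp g1 f1 rfl,
    .add (.add (.comp g1 f2 (by omega)) (.comp g2 f1 (by omega))) (.comp g4 f3 (by omega)),
    .add (.comp g3 f1 rfl) (.comp g5 f3 rfl),
    .add (.comp g1 f4 (by omega)) (.comp g4 f5 (by omega)), .comp g5 f5 rfl⟩

theorem htpyComp {g : SMap T U} {f : SMap S T} (hg : g.DegreesAt l) (hf : f.DegreesAt k)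
    (hm : m = k + l) : (htpyComp g f).DegreesAt m := by
  subst hm
  obtain ⟨g1, g2, g3, g4, g5⟩ := hg
  obtain ⟨f1, f2, f3, f4, f5⟩ := hf
  exact ⟨.comp g1 f1 rfl,
    .add (.sub (.comp g2 f1 (by omega)) (.comp g1 f2 (by omega))) (.comp g4 f3 (by omega)),
    .add (.comp g3 f1 rfl) (.comp g5 f3 rfl),
    .sub (.comp g4 f5 (by omega)) (.comp g1 f4 (by omega)), .comp g5 f5 rfl⟩

theorem suspMap {f : SMap S T} (hS : S.Degrees) (hT : T.Degrees) (hf : f.DegreesAt k) :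
    (suspMap f).DegreesAt k := by
  obtain ⟨-, -, -, s4, -⟩ := hS
  obtain ⟨-, t2, t3, -, -⟩ := hT
  obtain ⟨f1, f2, f3, f4, f5⟩ := hf
  exact ⟨susp_prod (.add (.comp f1 susp_fst (by omega)) (.comp f4 susp_snd (by omega)))
      (.comp f5 susp_snd (by omega)),
    susp_prod (.comp f2 susp_fst (by omega)) (.comp f3 susp_fst (by omega)), .zero,
    susp_prod (.add (.comp f2 s4 (by omega)) (.comp t2 f4 (by omega)))
      (.add (.comp f3 s4 (by omega)) (.comp t3 f4 (by omega))), f5⟩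

theorem suspHtpy {K : SMap S T} (hS : S.Degrees) (hT : T.Degrees) (hK : K.DegreesAt k) :
    (suspHtpy K).DegreesAt k := by
  obtain ⟨-, -, -, s4, -⟩ := hS
  obtain ⟨-, t2, t3, -, -⟩ := hT
  obtain ⟨f1, f2, f3, f4, f5⟩ := hK
  exact ⟨susp_prod (.sub (.comp f1 susp_fst (by omega)) (.comp f4 susp_snd (by omega)))
      (.neg (.comp f5 susp_snd (by omega))),
    susp_prod (.comp f2 susp_fst (by omega)) (.comp f3 susp_fst (by omega)), .zero,
    susp_prod (.add (.comp t2 f4 (by omega)) (.comp f2 s4 (by omega)))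
      (.add (.comp t3 f4 (by omega)) (.comp f3 s4 (by omega))), f5⟩

theorem suspCompHtpy {g : SMap T U} {f : SMap S T} (hg : g.DegreesAt 0) (hf : f.DegreesAt 0) :
    (suspCompHtpy g f).DegreesAt 1 := by
  obtain ⟨-, g2, g3, -, -⟩ := hg
  obtain ⟨-, -, -, f4, -⟩ := hf
  exact ⟨.zero, .zero, .zero, susp_prod (.comp g2 f4 rfl) (.comp g3 f4 rfl), .zero⟩

theorem negSuspMap {f : SMap S T} (hS : S.Degrees) (hT : T.Degrees) (hf : f.DegreesAt k) :
    (negSuspMap f).DegreesAt k := by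
  obtain ⟨-, s2, -, s4, -⟩ := hS
  obtain ⟨-, -, t3, -, -⟩ := hT
  obtain ⟨f1, f2, f3, f4, f5⟩ := hf
  exact ⟨negSusp_prod (.comp f1 negSusp_fst (by omega))
      (.add (.comp f3 negSusp_fst (by omega)) (.comp f5 negSusp_snd (by omega))),
    negSusp_prod (.add (.comp f2 negSusp_fst (by omega)) (.comp f4 negSusp_snd (by omega))) .zero,
    .add
      (.comp (k := 2) (l := k - 2)
        (.add (.comp t3 f2 (by omega)) (.comp f3 s2 (by omega))) negSusp_fst (by omega))
      (.comp (k := 2) (l := k - 2)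
        (.add (.comp t3 f4 (by omega)) (.comp f3 s4 (by omega))) negSusp_snd (by omega)),
    .zero, f5⟩

theorem negSuspCompHtpy {g : SMap T U} {f : SMap S T} (hg : g.DegreesAt 0)
    (hf : f.DegreesAt 0) : (negSuspCompHtpy g f).DegreesAt 1 := by
  obtain ⟨-, -, g3, -, -⟩ := hg
  obtain ⟨-, f2, -, f4, -⟩ := hf
  exact ⟨.zero, .zero, .add (.comp g3 (.comp f2 negSusp_fst rfl) rfl)
    (.comp g3 (.comp f4 negSusp_snd rfl) rfl), .zero, .zero⟩

end SMap.DegreesAt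

namespace SMap

variable {S T U : SCData R}

/-- The morphisms `f~` and `g~` are `S`-chain homotopic. -/
def Homotopic (f g : SMap S T) : Prop :=
  ∃ K : SMap S T, K.DegreesAt 1 ∧ IsHtpyFrom K f g

namespace Homotopic

theorem refl (f : SMap S T) : Homotopic f f :=
  ⟨⟨0, 0, 0, 0, 0⟩, ⟨.zero, .zero, .zero, .zero, .zero⟩, by simp [isHtpyFrom_iff]⟩

theorem trans {f g h : SMap S T} : Homotopic f g → Homotopic g h → Homotopic f h := by
  rintro ⟨K, ⟨a1, a2, a3, a4, a5⟩, hK⟩ ⟨L, ⟨b1, b2, b3, b4, b5⟩, hL⟩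
  refine ⟨⟨K.lam + L.lam, K.mu + L.mu, K.del1 + L.del1, K.del2 + L.del2, K.rho + L.rho⟩,
    ⟨a1.add b1, a2.add b2, a3.add b3, a4.add b4, a5.add b5⟩, ?_⟩
  rw [isHtpyFrom_iff] at *
  obtain ⟨k1, k2, k3, k4, k5⟩ := hK
  obtain ⟨l1, l2, l3, l4, l5⟩ := hL
  refine ⟨fun x => ?_, fun x => ?_, fun x => ?_, fun x => ?_, fun x => ?_⟩ <;>
    simp only [LinearMap.add_apply, map_add, *] <;> abel

theorem comp_left {g : SMap T U} {f f' : SMap S T} (hg : g.IsMor) (dg : g.DegreesAt 0) :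
    Homotopic f f' → Homotopic (g.comp f) (g.comp f') := fun ⟨K, dK, hK⟩ =>
  ⟨g.comp K, dg.comp dK rfl, hK.comp_left hg⟩

theorem comp_right {g g' : SMap T U} {f : SMap S T} (hf : f.IsMor) (df : f.DegreesAt 0) :
    Homotopic g g' → Homotopic (g.comp f) (g'.comp f) := fun ⟨K, dK, hK⟩ =>
  ⟨htpyComp K f, dK.htpyComp df rfl, hK.comp_right hf⟩

end Homotopic

end SMap

theorem sHomotopyEquiv_iff {S T : SCData R} : SHomotopyEquiv S T ↔
    ∃ (f : SMap S T) (g : SMap T S), f.IsMor ∧ f.DegreesAt 0 ∧ g.IsMor ∧ g.DegreesAt 0 ∧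
      SMap.Homotopic (g.comp f) (idMap S) ∧ SMap.Homotopic (f.comp g) (idMap T) := by
  constructor
  · rintro ⟨f, g, H₁, H₂, hf, df, hg, dg, d₁, h₁, d₂, h₂⟩
    exact ⟨f, g, hf, df, hg, dg, ⟨H₁, d₁, h₁⟩, ⟨H₂, d₂, h₂⟩⟩
  · rintro ⟨f, g, hf, df, hg, dg, ⟨H₁, d₁, h₁⟩, ⟨H₂, d₂, h₂⟩⟩
    exact ⟨f, g, H₁, H₂, hf, df, hg, dg, d₁, h₁, d₂, h₂⟩

namespace SHomotopyEquiv

variable {S T U : SCData R}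

theorem refl (S : SCData R) : SHomotopyEquiv S S :=
  sHomotopyEquiv_iff.mpr ⟨idMap S, idMap S, SMap.isMor_idMap, .idMap, SMap.isMor_idMap, .idMap,
    by rw [SMap.idMap_comp]; exact .refl _, by rw [SMap.idMap_comp]; exact .refl _⟩

theorem symm (h : SHomotopyEquiv S T) : SHomotopyEquiv T S := by
  obtain ⟨f, g, hf, df, hg, dg, h₁, h₂⟩ := sHomotopyEquiv_iff.mp h
  exact sHomotopyEquiv_iff.mpr ⟨g, f, hg, dg, hf, df, h₂, h₁⟩

theorem trans (h : SHomotopyEquiv S T) (h' : SHomotopyEquiv T U) : SHomotopyEquiv S U := by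
  obtain ⟨f, g, hf, df, hg, dg, h₁, h₂⟩ := sHomotopyEquiv_iff.mp h
  obtain ⟨f', g', hf', df', hg', dg', h₁', h₂'⟩ := sHomotopyEquiv_iff.mp h'
  refine sHomotopyEquiv_iff.mpr ⟨f'.comp f, g.comp g', hf'.comp hf, df'.comp df rfl,
    hg.comp hg', dg.comp dg' rfl, .trans ?_ h₁, .trans ?_ h₂'⟩
  · have := (h₁'.comp_right hf df).comp_left hg dg
    rwa [SMap.idMap_comp, SMap.comp_assoc, ← SMap.comp_assoc] at this
  · have := (h₂.comp_right hg' dg').comp_left hf' df'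
    rwa [SMap.idMap_comp, SMap.comp_assoc, ← SMap.comp_assoc] at this

theorem susp (hS : S.Relations) (hT : T.Relations) (dS : S.Degrees) (dT : T.Degrees)
    (h : SHomotopyEquiv S T) : SHomotopyEquiv S.susp T.susp := by
  obtain ⟨f, g, H₁, H₂, hf, df, hg, dg, d₁, h₁, d₂, h₂⟩ := h
  have e₁ := h₁.suspHtpy hS hS
  have e₂ := h₂.suspHtpy hT hT
  rw [SMap.suspMap_idMap] at e₁ e₂
  exact sHomotopyEquiv_iff.mpr ⟨suspMap f, suspMap g, hf.suspMap hS hT, df.suspMap dS dT,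
    hg.suspMap hT hS, dg.suspMap dT dS,
    .trans ⟨_, dg.suspCompHtpy df, SMap.isHtpyFrom_suspCompHtpy hg hf⟩ ⟨_, d₁.suspHtpy dS dS, e₁⟩,
    .trans ⟨_, df.suspCompHtpy dg, SMap.isHtpyFrom_suspCompHtpy hf hg⟩ ⟨_, d₂.suspHtpy dT dT, e₂⟩⟩

theorem negSusp (hS : S.Relations) (hT : T.Relations) (dS : S.Degrees) (dT : T.Degrees)
    (h : SHomotopyEquiv S T) : SHomotopyEquiv S.negSusp T.negSusp := by
  obtain ⟨f, g, H₁, H₂, hf, df, hg, dg, d₁, h₁, d₂, h₂⟩ := h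
  have e₁ := h₁.negSuspMap hS hS
  have e₂ := h₂.negSuspMap hT hT
  rw [SMap.negSuspMap_idMap] at e₁ e₂
  exact sHomotopyEquiv_iff.mpr ⟨SMap.negSuspMap f, SMap.negSuspMap g, hf.negSuspMap hS hT,
    df.negSuspMap dS dT, hg.negSuspMap hT hS, dg.negSuspMap dT dS,
    .trans ⟨_, dg.negSuspCompHtpy df, SMap.isHtpyFrom_negSuspCompHtpy hg hf⟩
      ⟨_, d₁.negSuspMap dS dS, e₁⟩,
    .trans ⟨_, df.negSuspCompHtpy dg, SMap.isHtpyFrom_negSuspCompHtpy hf hg⟩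
      ⟨_, d₂.negSuspMap dT dT, e₂⟩⟩

end SHomotopyEquiv

namespace SCData

open GradedMod.IsDeg

/-- The projection `ΣΣ⁻¹C~ → C~`. -/
def fromSuspNegSusp (S : SCData R) : SMap S.negSusp.susp S where
  lam := LinearMap.fst R S.Irr.carrier S.Red.carrier ∘ₗ
    LinearMap.fst R (S.Irr.carrier × S.Red.carrier) S.Red.carrier
  mu := 0
  del1 := LinearMap.snd R S.Irr.carrier S.Red.carrier ∘ₗ
    LinearMap.fst R (S.Irr.carrier × S.Red.carrier) S.Red.carrier
  del2 := 0
  rho := LinearMap.id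

/-- The inclusion `C~ → ΣΣ⁻¹C~`. -/
def toSuspNegSusp (S : SCData R) : SMap S S.negSusp.susp where
  lam := LinearMap.prod (LinearMap.prod LinearMap.id 0 : _ →ₗ[R] S.Irr.carrier × S.Red.carrier) S.δ₁
  mu := 0
  del1 := 0
  del2 := 0
  rho := LinearMap.id

/-- The homotopy on `ΣΣ⁻¹C~` contracting the complement of `C~`. -/
def suspNegSuspHtpy (S : SCData R) : SMap S.negSusp.susp S.negSusp.susp where
  lam := LinearMap.prod 0 (LinearMap.snd R S.Irr.carrier S.Red.carrier ∘ₗ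
    LinearMap.fst R (S.Irr.carrier × S.Red.carrier) S.Red.carrier)
  mu := 0
  del1 := 0
  del2 := 0
  rho := 0

/-- The projection `Σ⁻¹ΣC~ → C~`. -/
def fromNegSuspSusp (S : SCData R) : SMap S.susp.negSusp S where
  lam := LinearMap.fst R S.Irr.carrier S.Red.carrier ∘ₗ
      LinearMap.fst R (S.Irr.carrier × S.Red.carrier) S.Red.carrier +
    S.δ₂ ∘ₗ LinearMap.snd R (S.Irr.carrier × S.Red.carrier) S.Red.carrier
  mu := 0
  del1 := 0
  del2 := 0
  rho := LinearMap.id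

/-- The inclusion `C~ → Σ⁻¹ΣC~`. -/
def toNegSuspSusp (S : SCData R) : SMap S S.susp.negSusp where
  lam := LinearMap.prod (LinearMap.prod LinearMap.id 0 : _ →ₗ[R] S.Irr.carrier × S.Red.carrier)
    (0 : _ →ₗ[R] S.Red.carrier)
  mu := 0
  del1 := 0
  del2 := LinearMap.prod (LinearMap.prod 0 LinearMap.id : _ →ₗ[R] S.Irr.carrier × S.Red.carrier)
    (0 : _ →ₗ[R] S.Red.carrier)
  rho := LinearMap.id

/-- The homotopy on `Σ⁻¹ΣC~` contracting the complement of `C~`. -/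
def negSuspSuspHtpy (S : SCData R) : SMap S.susp.negSusp S.susp.negSusp where
  lam := LinearMap.prod
    (LinearMap.prod 0 (-LinearMap.snd R (S.Irr.carrier × S.Red.carrier) S.Red.carrier) :
      _ →ₗ[R] S.Irr.carrier × S.Red.carrier)
    (0 : _ →ₗ[R] S.Red.carrier)
  mu := 0
  del1 := 0
  del2 := 0
  rho := 0

variable {S : SCData R}

theorem fromSuspNegSusp_comp : S.fromSuspNegSusp.comp S.toSuspNegSusp = idMap S := by
  delta fromSuspNegSusp toSuspNegSusp SMap.comp idMap SCData.susp SCData.negSusp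
  simp only [SMap.mk.injEq]
  refine ⟨?_, ?_, ?_, ?_, ?_⟩ <;> ext <;> simp

theorem fromNegSuspSusp_comp : S.fromNegSuspSusp.comp S.toNegSuspSusp = idMap S := by
  delta fromNegSuspSusp toNegSuspSusp SMap.comp idMap SCData.susp SCData.negSusp
  simp only [SMap.mk.injEq]
  refine ⟨?_, ?_, ?_, ?_, ?_⟩ <;> ext <;> simp

theorem susp_negSusp_equiv (hS : S.Relations) (dS : S.Degrees) :
    SHomotopyEquiv S.negSusp.susp S := by
  obtain ⟨-, -, d1, -, -⟩ := dS
  rw [relations_iff] at hS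
  obtain ⟨s1, s2, s3, s4, s5⟩ := hS
  refine sHomotopyEquiv_iff.mpr ⟨S.fromSuspNegSusp, S.toSuspNegSusp, SMap.isMor_iff.mpr ?_,
    ⟨.comp negSusp_fst susp_fst rfl, .zero, .comp negSusp_snd susp_fst rfl, .zero, .id rfl⟩,
    SMap.isMor_iff.mpr ?_,
    ⟨susp_prod (negSusp_prod (.id rfl) .zero) d1, .zero, .zero, .zero, .id rfl⟩,
    ⟨S.suspNegSuspHtpy,
      ⟨susp_prod .zero (.comp negSusp_snd susp_fst rfl), .zero, .zero, .zero, .zero⟩,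
      SMap.isHtpyFrom_iff.mpr ?_⟩,
    by rw [fromSuspNegSusp_comp]; exact .refl _⟩
  · refine ⟨fun ((x, y), (z : S.Red.carrier)) => ?_,
      fun ((x, y), (z : S.Red.carrier)) => ?_, fun (x : S.Red.carrier) => ?_,
      fun ((x, y), (z : S.Red.carrier)) => ?_, fun (x : S.Red.carrier) => ?_⟩ <;>
      delta fromSuspNegSusp SCData.susp SCData.negSusp <;> simp [*]
  · refine ⟨fun x => Prod.ext (Prod.ext ?_ ?_) ?_, fun x => ?_,
      fun x => Prod.ext (Prod.ext ?_ ?_) ?_, fun x => Prod.ext (Prod.ext ?_ ?_) ?_, fun x => ?_⟩ <;>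
      delta toSuspNegSusp SCData.susp SCData.negSusp <;> simp [*]
  · refine ⟨fun ((x, y), (z : S.Red.carrier)) => Prod.ext (Prod.ext ?_ ?_) ?_,
      fun ((x, y), (z : S.Red.carrier)) => ?_,
      fun (x : S.Red.carrier) => Prod.ext (Prod.ext ?_ ?_) ?_,
      fun ((x, y), (z : S.Red.carrier)) => Prod.ext (Prod.ext ?_ ?_) ?_,
      fun (x : S.Red.carrier) => ?_⟩ <;>
      delta suspNegSuspHtpy toSuspNegSusp fromSuspNegSusp SMap.comp idMap SCData.susp
        SCData.negSusp <;> simp [*]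

theorem negSusp_susp_equiv (hS : S.Relations) (dS : S.Degrees) :
    SHomotopyEquiv S.susp.negSusp S := by
  obtain ⟨-, -, -, d2, -⟩ := dS
  rw [relations_iff] at hS
  obtain ⟨s1, s2, s3, s4, s5⟩ := hS
  refine sHomotopyEquiv_iff.mpr ⟨S.fromNegSuspSusp, S.toNegSuspSusp, SMap.isMor_iff.mpr ?_,
    ⟨.add (.comp susp_fst negSusp_fst rfl) (.comp d2 negSusp_snd rfl), .zero, .zero, .zero, .id rfl⟩,
    SMap.isMor_iff.mpr ?_,
    ⟨negSusp_prod (susp_prod (.id rfl) .zero) .zero, .zero, .zero,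
      negSusp_prod (susp_prod .zero (.id rfl)) .zero, .id rfl⟩,
    ⟨S.negSuspSuspHtpy,
      ⟨negSusp_prod (susp_prod .zero (.neg negSusp_snd)) .zero, .zero, .zero, .zero, .zero⟩,
      SMap.isHtpyFrom_iff.mpr ?_⟩,
    by rw [fromNegSuspSusp_comp]; exact .refl _⟩
  · refine ⟨fun ((x, y), (z : S.Red.carrier)) => ?_,
      fun ((x, y), (z : S.Red.carrier)) => ?_, fun (x : S.Red.carrier) => ?_,
      fun ((x, y), (z : S.Red.carrier)) => ?_, fun (x : S.Red.carrier) => ?_⟩ <;>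
      delta fromNegSuspSusp SCData.susp SCData.negSusp <;> simp [*] <;> abel
  · refine ⟨fun x => Prod.ext (Prod.ext ?_ ?_) ?_, fun x => ?_,
      fun x => Prod.ext (Prod.ext ?_ ?_) ?_, fun x => Prod.ext (Prod.ext ?_ ?_) ?_, fun x => ?_⟩ <;>
      delta toNegSuspSusp SCData.susp SCData.negSusp <;> simp [*]
  · refine ⟨fun ((x, y), (z : S.Red.carrier)) => Prod.ext (Prod.ext ?_ ?_) ?_,
      fun ((x, y), (z : S.Red.carrier)) => ?_,
      fun (x : S.Red.carrier) => Prod.ext (Prod.ext ?_ ?_) ?_,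
      fun ((x, y), (z : S.Red.carrier)) => Prod.ext (Prod.ext ?_ ?_) ?_,
      fun (x : S.Red.carrier) => ?_⟩ <;>
      delta negSuspSuspHtpy toNegSuspSusp fromNegSuspSusp SMap.comp idMap SCData.susp
        SCData.negSusp <;> simp [*]

end SCData

namespace SCData

variable {S : SCData R}

theorem suspPow_induction {p : SCData R → Prop} (hp : ∀ X, p X → p X.susp)
    (hn : ∀ X, p X → p X.negSusp) (hS : p S) : ∀ n : ℤ, p (S.suspPow n)
  | Int.ofNat n => Function.Iterate.rec p hS (fun X => hp X) n
  | Int.negSucc n => Function.Iterate.rec p hS (fun X => hn X) (n + 1)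

theorem Relations.suspPow (hS : S.Relations) (n : ℤ) : (S.suspPow n).Relations :=
  suspPow_induction (p := Relations) (fun _ => Relations.susp) (fun _ => Relations.negSusp) hS n

theorem Degrees.suspPow (hS : S.Degrees) (n : ℤ) : (S.suspPow n).Degrees :=
  suspPow_induction (p := Degrees) (fun _ => Degrees.susp) (fun _ => Degrees.negSusp) hS n

theorem suspPow_natCast_succ (n : ℕ) : S.suspPow ((n : ℤ) + 1) = (S.suspPow n).susp :=
  Function.iterate_succ_apply' (fun X : SCData R => X.susp) n S

theorem suspPow_neg_natCast_sub_one (n : ℕ) :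
    S.suspPow (-(n : ℤ) - 1) = (S.suspPow (-(n : ℤ))).negSusp := by
  cases n with
  | zero => rfl
  | succ n =>
    have h : -((n + 1 : ℕ) : ℤ) - 1 = Int.negSucc (n + 1) := by omega
    rw [h]
    exact Function.iterate_succ_apply' (fun X : SCData R => X.negSusp) (n + 1) S

theorem suspPow_add_one_equiv (hS : S.Relations) (dS : S.Degrees) (n : ℤ) :
    SHomotopyEquiv (S.suspPow (n + 1)) (S.suspPow n).susp := by
  obtain ⟨k, rfl | rfl⟩ := n.eq_nat_or_neg
  · rw [suspPow_natCast_succ]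
    exact .refl _
  · cases k with
    | zero => exact .refl _
    | succ k =>
      have h : -((k + 1 : ℕ) : ℤ) = -(k : ℤ) - 1 := by omega
      rw [h, sub_add_cancel, suspPow_neg_natCast_sub_one]
      exact (susp_negSusp_equiv (hS.suspPow _) (dS.suspPow _)).symm

theorem suspPow_sub_one_equiv (hS : S.Relations) (dS : S.Degrees) (n : ℤ) :
    SHomotopyEquiv (S.suspPow (n - 1)) (S.suspPow n).negSusp := by
  obtain ⟨k, rfl | rfl⟩ := n.eq_nat_or_neg
  · cases k with
    | zero => exact .refl _
    | succ k =>
      rw [Nat.cast_succ, add_sub_cancel_right, suspPow_natCast_succ]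
      exact (negSusp_susp_equiv (hS.suspPow _) (dS.suspPow _)).symm
  · rw [suspPow_neg_natCast_sub_one]
    exact .refl _

theorem suspPow_suspPow_equiv (hS : S.Relations) (dS : S.Degrees) (i j : ℤ) :
    SHomotopyEquiv ((S.suspPow j).suspPow i) (S.suspPow (i + j)) := by
  have hj := hS.suspPow j
  have dj := dS.suspPow j
  induction i with
  | zero => rw [zero_add]; exact .refl _
  | succ i ih =>
    rw [add_right_comm]
    exact ((suspPow_add_one_equiv hj dj _).trans
      (ih.susp (hj.suspPow _) (hS.suspPow _) (dj.suspPow _) (dS.suspPow _))).trans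
      (suspPow_add_one_equiv hS dS _).symm
  | pred i ih =>
    rw [sub_add_eq_add_sub]
    exact ((suspPow_sub_one_equiv hj dj _).trans
      (ih.negSusp (hj.suspPow _) (hS.suspPow _) (dj.suspPow _) (dS.suspPow _))).trans
      (suspPow_sub_one_equiv hS dS _).symm

end SCData

/-- For every `S`-complex and all integers `i, j`, there is an `S`-chain
homotopy equivalence `Σ^i Σ^j C~ ≃ Σ^{i+j} C~`; in particular `ΣΣ⁻¹C~ ≃ C~ ≃ Σ⁻¹ΣC~`. -/
theorem suspPow_add_homotopyEquiv {R : Type u} [CommRing R] (S : SCData R)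
    (hS : S.IsSComplex) :
    (∀ i j : ℤ, SHomotopyEquiv ((S.suspPow j).suspPow i) (S.suspPow (i + j))) ∧
    SHomotopyEquiv S.negSusp.susp S ∧ SHomotopyEquiv S.susp.negSusp S := by
  obtain ⟨-, -, dS, hS⟩ := hS
  exact ⟨SCData.suspPow_suspPow_equiv hS dS, SCData.susp_negSusp_equiv hS dS,
    SCData.negSusp_susp_equiv hS dS⟩
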